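/- arXiv:2303.07691 — 4 statements merged into one kernel-verified Lean document; each statement's English description precedes it below -/
import Mathlib

section
/- Let X be a real Banach space, A ⊆ X* a subset and η ∈ X*. The following are equivalent: (1) η ∉ Ienv(A); (2) there is a sequence (x_n) in the closed unit ball of X with sup_{ξ∈A} limsup_{n→∞} ξ(x_n) < inf_{n∈ℕ} η(x_n); (3) there is a sequence (x_n) in the closed unit ball of X with sup_{ξ∈A} limsup_{n→∞} ξ(x_n) < liminf_{n→∞} η(x_n); (4) there is a sequence (x_n) in the closed unit ball of X with sup_{ξ∈A} limsup_{n→∞} ξ(x_n) < limsup_{n→∞} η(x_n) (all suprema/infima/limits taken in the extended reals). -/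
open Filter Topology

noncomputable section

/-- The weak* topology on the dual of `E`: pointwise convergence on `E`. -/
def wstarTop (E : Type*) [NormedAddCommGroup E] [NormedSpace ℝ E] :
    TopologicalSpace (E →L[ℝ] ℝ) :=
  TopologicalSpace.induced (fun f (x : E) => f x) Pi.topologicalSpace

/-- Weak* closure of a set of functionals. -/
def wstarClosure {E : Type*} [NormedAddCommGroup E] [NormedSpace ℝ E]
    (A : Set (E →L[ℝ] ℝ)) : Set (E →L[ℝ] ℝ) :=
  @closure _ (wstarTop E) A

/-- The (I)-envelope of a set in a dual Banach space. -/
def Ienv {E : Type*} [NormedAddCommGroup E] [NormedSpace ℝ E]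
    (A : Set (E →L[ℝ] ℝ)) : Set (E →L[ℝ] ℝ) :=
  ⋂ (As : ℕ → Set (E →L[ℝ] ℝ)) (_ : A = ⋃ n, As n),
    closure (convexHull ℝ (⋃ n, wstarClosure (convexHull ℝ (As n))))

/-- `B₁(E)`: elements of the bidual that are weak* limits of sequences from `E`. -/
def B1 (E : Type*) [NormedAddCommGroup E] [NormedSpace ℝ E] :
    Set ((E →L[ℝ] ℝ) →L[ℝ] ℝ) :=
  {F | ∃ x : ℕ → E, ∀ ξ : E →L[ℝ] ℝ,
    Tendsto (fun n => ξ (x n)) atTop (𝓝 (F ξ))}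

/-- `C(E)`: elements of the bidual lying in the weak* closure of a countable subset of `E`. -/
def CX (E : Type*) [NormedAddCommGroup E] [NormedSpace ℝ E] :
    Set ((E →L[ℝ] ℝ) →L[ℝ] ℝ) :=
  {F | ∃ C : Set E, C.Countable ∧
    F ∈ wstarClosure ((fun x => NormedSpace.inclusionInDoubleDual ℝ E x) '' C)}

/-- The topology `σ(E*, Y)` for a set `Y` of elements of the bidual. -/
def sigmaTop {E : Type*} [NormedAddCommGroup E] [NormedSpace ℝ E]
    (Y : Set ((E →L[ℝ] ℝ) →L[ℝ] ℝ)) : TopologicalSpace (E →L[ℝ] ℝ) :=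
  TopologicalSpace.induced
    (fun f (y : Y) => (y : (E →L[ℝ] ℝ) →L[ℝ] ℝ) f) Pi.topologicalSpace

end

theorem aux_union_compact {E : Type*} [AddCommGroup E] [Module ℝ E] [TopologicalSpace E]
    [ContinuousAdd E] [ContinuousSMul ℝ E] {s t : Set E} (hs : Convex ℝ s) (ht : Convex ℝ t)
    (ks : IsCompact s) (kt : IsCompact t) : IsCompact (convexHull ℝ (s ∪ t)) := by
  rcases s.eq_empty_or_nonempty with rfl | hs0
  · simpa [ht.convexHull_eq] using kt
  rcases t.eq_empty_or_nonempty with rfl | ht0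
  · simpa [hs.convexHull_eq] using ks
  rw [hs.convexHull_union ht hs0 ht0]
  have : convexJoin ℝ s t =
      (fun p : ℝ × E × E => (1 - p.1) • p.2.1 + p.1 • p.2.2) '' (Set.Icc (0:ℝ) 1 ×ˢ (s ×ˢ t)) := by
    ext z
    simp only [mem_convexJoin, segment_eq_image, Set.mem_image, Set.mem_prod, Prod.exists]
    constructor
    · rintro ⟨a, ha, b, hb, θ, hθ, rfl⟩
      exact ⟨θ, a, b, ⟨hθ, ha, hb⟩, rfl⟩
    · rintro ⟨θ, a, b, ⟨hθ, ha, hb⟩, rfl⟩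
      exact ⟨a, ha, b, hb, θ, hθ, rfl⟩
  rw [this]
  exact (isCompact_Icc.prod (ks.prod kt)).image (by fun_prop)

theorem aux_wstar {X : Type*} [NormedAddCommGroup X] [NormedSpace ℝ X] (B : Set (X →L[ℝ] ℝ)) :
    WeakDual.toStrongDual ⁻¹' (wstarClosure B) =
      closure ((WeakDual.toStrongDual : WeakDual ℝ X → StrongDual ℝ X) ⁻¹' B) := by
  rfl

open scoped Pointwise in
theorem aux_sep {X : Type*} [NormedAddCommGroup X] [NormedSpace ℝ X]
    (L : Set (WeakDual ℝ X)) (hL : Convex ℝ L) (kL : IsCompact L) (η : X →L[ℝ] ℝ)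
    (δ : ℝ) (hδ : 0 < δ) (h : ∀ ζ ∈ L, δ < ‖η - WeakDual.toStrongDual ζ‖) :
    ∃ x : X, ‖x‖ ≤ 1 ∧ ∀ ζ ∈ L, ζ x ≤ η x - δ := by
  rcases L.eq_empty_or_nonempty with rfl | ⟨ζ₀, hζ₀⟩
  · exact ⟨0, by simp, by simp⟩
  let D : Set (WeakDual ℝ X) := WeakDual.toStrongDual ⁻¹' Metric.closedBall 0 δ
  have kD : IsCompact D := WeakDual.isCompact_closedBall (𝕜 := ℝ) 0 δ
  have cD : Convex ℝ D :=
    (convex_closedBall (0 : StrongDual ℝ X) δ).linear_preimage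
      (WeakDual.toStrongDual : WeakDual ℝ X ≃ₗ[ℝ] StrongDual ℝ X).toLinearMap
  have hη : StrongDual.toWeakDual η ∉ L + D := by
    rintro ⟨ζ, hζ, b, hb, e⟩
    have h1 := h ζ hζ
    have e' : WeakDual.toStrongDual ζ + WeakDual.toStrongDual b = η := e
    have hb' : ‖WeakDual.toStrongDual b‖ ≤ δ := by simpa [D] using hb
    rw [← e', add_sub_cancel_left] at h1
    linarith
  haveI : LocallyConvexSpace ℝ (WeakDual ℝ X) :=
    inferInstanceAs (LocallyConvexSpace ℝ (WeakBilin (topDualPairing ℝ X)))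
  obtain ⟨f, u, hf, hu⟩ := geometric_hahn_banach_closed_point (hL.add cD) (kL.add kD).isClosed hη
  obtain ⟨x, hx⟩ := LinearMap.dualEmbedding_surjective (topDualPairing ℝ X) f
  have hfx : ∀ ζ : WeakDual ℝ X, f ζ = ζ x := by
    intro ζ; rw [← hx]; rfl
  obtain ⟨g, hg, hgx⟩ := exists_dual_vector'' ℝ x
  have key : ∀ ζ ∈ L, ζ x + δ * ‖x‖ < η x := by
    intro ζ hζ
    have h1 := hf (ζ + StrongDual.toWeakDual (δ • g)) (Set.add_mem_add hζ (by
      change δ • g ∈ Metric.closedBall 0 δ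
      rw [mem_closedBall_zero_iff, norm_smul, Real.norm_of_nonneg hδ.le]
      nlinarith))
    rw [hfx] at h1 hu
    have e : (ζ + StrongDual.toWeakDual (δ • g)) x = ζ x + δ * ‖x‖ := by
      have : (ζ + StrongDual.toWeakDual (δ • g)) x = ζ x + δ * g x := rfl
      rw [this, hgx]; rfl
    rw [e] at h1
    exact h1.trans hu
  have hx0 : 0 < ‖x‖ := by
    rw [norm_pos_iff]
    rintro rfl
    have := key ζ₀ hζ₀
    simp at this
  refine ⟨‖x‖⁻¹ • x, ?_, ?_⟩
  · rw [norm_smul, norm_inv, norm_norm, inv_mul_cancel₀ hx0.ne']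
  · intro ζ hζ
    have h1 := key ζ hζ
    rw [map_smul, map_smul, smul_eq_mul, smul_eq_mul]
    have h2 := mul_lt_mul_of_pos_left h1 (inv_pos.2 hx0)
    have h3 : ‖x‖⁻¹ * (ζ x + δ * ‖x‖) = ‖x‖⁻¹ * ζ x + δ := by field_simp
    linarith

theorem aux_12 {X : Type*} [NormedAddCommGroup X] [NormedSpace ℝ X]
    (A : Set (X →L[ℝ] ℝ)) (η : X →L[ℝ] ℝ) (h : η ∉ Ienv A) :
    ∃ x : ℕ → X, (∀ n, ‖x n‖ ≤ 1) ∧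
          (⨆ ξ ∈ A, limsup (fun n => ((ξ (x n) : ℝ) : EReal)) atTop) <
            ⨅ n, ((η (x n) : ℝ) : EReal) := by
  simp only [Ienv, Set.mem_iInter, not_forall] at h
  obtain ⟨As, hAs, h⟩ := h
  set C := convexHull ℝ (⋃ n, wstarClosure (convexHull ℝ (As n))) with hC
  obtain ⟨ε, hε, hball⟩ : ∃ ε > 0, ∀ ζ ∈ C, ε ≤ dist η ζ := by
    rw [Metric.mem_closure_iff] at h
    push Not at h
    exact h
  let T : WeakDual ℝ X → StrongDual ℝ X := WeakDual.toStrongDual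
  let B : ℕ → Set (X →L[ℝ] ℝ) := fun n => As n.unpair.1 ∩ Metric.closedBall 0 (n.unpair.2 : ℝ)
  let K : ℕ → Set (WeakDual ℝ X) := fun n => closure (T ⁻¹' convexHull ℝ (B n))
  have cK : ∀ n, Convex ℝ (K n) := fun n =>
    ((convex_convexHull ℝ (B n)).linear_preimage
      (WeakDual.toStrongDual : WeakDual ℝ X ≃ₗ[ℝ] StrongDual ℝ X).toLinearMap).closure
  have kK : ∀ n, IsCompact (K n) := by
    intro n
    have k1 : IsCompact (T ⁻¹' Metric.closedBall 0 (n.unpair.2 : ℝ)) :=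
      WeakDual.isCompact_closedBall (𝕜 := ℝ) 0 _
    refine k1.of_isClosed_subset isClosed_closure (closure_minimal ?_ k1.isClosed)
    exact Set.preimage_mono (convexHull_min Set.inter_subset_right (convex_closedBall _ _))
  have KC : ∀ n, K n ⊆ T ⁻¹' C := by
    intro n
    have h1 : K n ⊆ T ⁻¹' wstarClosure (convexHull ℝ (As n.unpair.1)) := by
      rw [aux_wstar]
      exact closure_mono (Set.preimage_mono (convexHull_mono Set.inter_subset_left))
    refine h1.trans (Set.preimage_mono ?_)
    exact (Set.subset_iUnion (fun n => wstarClosure (convexHull ℝ (As n))) _).trans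
      (subset_convexHull ℝ _)
  have cC : Convex ℝ (T ⁻¹' C) := (convex_convexHull ℝ _).linear_preimage
      (WeakDual.toStrongDual : WeakDual ℝ X ≃ₗ[ℝ] StrongDual ℝ X).toLinearMap
  have hLex : ∀ n : ℕ, ∃ L : Set (WeakDual ℝ X), Convex ℝ L ∧ IsCompact L ∧ L ⊆ T ⁻¹' C ∧
      ∀ k ≤ n, K k ⊆ L := by
    intro n
    induction n with
    | zero => exact ⟨K 0, cK 0, kK 0, KC 0, fun k hk => by rw [Nat.le_zero.1 hk]⟩
    | succ n ih =>
      obtain ⟨L, h1, h2, h3, h4⟩ := ih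
      refine ⟨convexHull ℝ (L ∪ K (n+1)), convex_convexHull ℝ _,
        aux_union_compact h1 (cK _) h2 (kK _), convexHull_min (Set.union_subset h3 (KC _)) cC, ?_⟩
      intro k hk
      refine Set.Subset.trans ?_ (subset_convexHull ℝ _)
      rcases Nat.le_succ_iff.1 hk with hk | rfl
      · exact (h4 k hk).trans Set.subset_union_left
      · exact Set.subset_union_right
  have hx : ∀ n : ℕ, ∃ x : X, ‖x‖ ≤ 1 ∧ ∀ k ≤ n, ∀ ζ ∈ B k, ζ x ≤ η x - ε / 2 := by
    intro n
    obtain ⟨L, h1, h2, h3, h4⟩ := hLex n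
    obtain ⟨x, hx1, hx2⟩ := aux_sep L h1 h2 η (ε/2) (by positivity) (by
      intro ζ hζ
      have := hball (WeakDual.toStrongDual ζ) (h3 hζ)
      rw [dist_eq_norm] at this
      exact lt_of_lt_of_le (by linarith) this)
    refine ⟨x, hx1, fun k hk ζ hζ => hx2 (StrongDual.toWeakDual ζ) (h4 k hk (subset_closure ?_))⟩
    exact (show ζ ∈ convexHull ℝ (B k) from subset_convexHull ℝ (B k) hζ)
  choose x hx1 hx2 using hx
  obtain ⟨a, -, φ, hφ, ha⟩ := tendsto_subseq_of_bounded (x := fun n => η (x n))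
    (Metric.isBounded_closedBall (x := (0:ℝ)) (r := ‖η‖)) (fun n => by
      rw [mem_closedBall_zero_iff]
      exact (η.le_opNorm _).trans (mul_le_of_le_one_right (norm_nonneg _) (hx1 n)))
  obtain ⟨N, hN⟩ := (Metric.tendsto_atTop.1 ha) (ε/8) (by positivity)
  refine ⟨fun n => x (φ (n + N)), fun n => hx1 _, ?_⟩
  have hN' : ∀ n, a - ε/8 < η (x (φ (n+N))) ∧ η (x (φ (n+N))) < a + ε/8 := by
    intro n
    have := hN (n+N) (by omega)
    rw [Real.dist_eq, abs_lt] at this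
    simp only [Function.comp] at this
    constructor <;> linarith [this.1, this.2]
  have r : ((a - 3*ε/8 : ℝ) : EReal) ≤ ((a - ε/8 : ℝ) : EReal) := by
    exact_mod_cast (by linarith)
  have l : (⨆ ξ ∈ A, limsup (fun n => ((ξ (x (φ (n + N))) : ℝ) : EReal)) atTop)
      ≤ ((a - 3*ε/8 : ℝ) : EReal) := by
    refine iSup₂_le fun ξ hξ => ?_
    refine limsup_le_of_le (by isBoundedDefault) ?_
    rw [hAs] at hξ
    obtain ⟨i, hi⟩ := Set.mem_iUnion.1 hξ
    obtain ⟨j, hj⟩ := exists_nat_ge ‖ξ‖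
    have hB : ξ ∈ B (Nat.pair i j) := by
      simp only [B, Nat.unpair_pair]
      exact ⟨hi, by simpa using hj⟩
    filter_upwards [eventually_ge_atTop (Nat.pair i j)] with n hn
    have h1 : Nat.pair i j ≤ φ (n+N) := by
      have := hφ.id_le (n+N)
      simp only [id] at this
      omega
    have h2 := hx2 _ _ h1 ξ hB
    have h3 := (hN' n).2
    exact_mod_cast (by linarith)
  refine l.trans_lt (lt_of_lt_of_le (b := ((a - ε/8 : ℝ) : EReal)) ?_ ?_)
  · exact_mod_cast (by linarith)
  · exact le_iInf fun n => by exact_mod_cast (hN' n).1.le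

theorem aux_41 {X : Type*} [NormedAddCommGroup X] [NormedSpace ℝ X]
    (A : Set (X →L[ℝ] ℝ)) (η : X →L[ℝ] ℝ) (x : ℕ → X) (hx : ∀ n, ‖x n‖ ≤ 1)
    (h : (⨆ ξ ∈ A, limsup (fun n => ((ξ (x n) : ℝ) : EReal)) atTop) <
            limsup (fun n => ((η (x n) : ℝ) : EReal)) atTop) : η ∉ Ienv A := by
  obtain ⟨c, hc, h⟩ := EReal.lt_iff_exists_real_btwn.1 h
  obtain ⟨d, hd, h⟩ := EReal.lt_iff_exists_real_btwn.1 h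
  have hcd : c < d := by exact_mod_cast hd
  have hfreq : ∃ᶠ n in atTop, d < η (x n) := by
    refine (frequently_lt_of_lt_limsup (by isBoundedDefault) h).mono fun n hn => ?_
    exact_mod_cast hn
  intro hη
  simp only [Ienv, Set.mem_iInter] at hη
  let As : ℕ → Set (X →L[ℝ] ℝ) := fun m => {ξ ∈ A | ∀ k ≥ m, ξ (x k) ≤ c}
  have hAs : A = ⋃ m, As m := by
    ext ξ
    simp only [Set.mem_iUnion, As, Set.mem_setOf_eq]
    refine ⟨fun hξ => ?_, fun ⟨m, h, _⟩ => h⟩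
    have h1 : limsup (fun n => ((ξ (x n) : ℝ) : EReal)) atTop < c :=
      (le_iSup₂ (f := fun ξ (_ : ξ ∈ A) => limsup (fun n => ((ξ (x n) : ℝ) : EReal)) atTop)
        ξ hξ).trans_lt hc
    obtain ⟨m, hm⟩ := eventually_atTop.1 (eventually_lt_of_limsup_lt h1 (by isBoundedDefault))
    exact ⟨m, hξ, fun k hk => by exact_mod_cast (hm k hk).le⟩
  have h1 := hη As hAs
  let S : Set (X →L[ℝ] ℝ) := {ζ | ∀ᶠ k in atTop, ζ (x k) ≤ c}
  have cS : Convex ℝ S := by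
    intro ζ hζ ξ hξ a b ha hb hab
    filter_upwards [hζ, hξ] with k h1 h2
    simp only [ContinuousLinearMap.add_apply, ContinuousLinearMap.smul_apply, smul_eq_mul]
    calc a * ζ (x k) + b * ξ (x k) ≤ a * c + b * c := by gcongr
      _ = c := by rw [← add_mul, hab, one_mul]
  have hsub : convexHull ℝ (⋃ n, wstarClosure (convexHull ℝ (As n))) ⊆ S := by
    refine convexHull_min (Set.iUnion_subset fun m => ?_) cS
    intro ζ hζ
    have h2 : StrongDual.toWeakDual ζ ∈ ⋂ k ≥ m, {ξ : WeakDual ℝ X | ξ (x k) ≤ c} := by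
      refine closure_minimal (s := WeakDual.toStrongDual ⁻¹' (convexHull ℝ (As m))) ?_ ?_ hζ
      · intro ξ hξ
        simp only [Set.mem_iInter]
        intro k hk
        have h3 : convexHull ℝ (As m) ⊆ {ξ : X →L[ℝ] ℝ | ξ (x k) ≤ c} := by
          refine convexHull_min (fun ξ hξ => hξ.2 k hk) ?_
          intro ζ hζ ξ hξ a b ha hb hab
          simp only [Set.mem_setOf_eq] at hζ hξ
          simp only [Set.mem_setOf_eq, ContinuousLinearMap.add_apply,
            ContinuousLinearMap.smul_apply, smul_eq_mul]
          calc a * ζ (x k) + b * ξ (x k) ≤ a * c + b * c := by gcongr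
            _ = c := by rw [← add_mul, hab, one_mul]
        exact h3 hξ
      · exact isClosed_biInter fun k _ =>
          isClosed_le (WeakDual.eval_continuous (x k)) continuous_const
    simp only [Set.mem_iInter] at h2
    exact eventually_atTop.2 ⟨m, fun k hk => h2 k hk⟩
  obtain ⟨ζ, hζ, hd'⟩ := Metric.mem_closure_iff.1 h1 (d - c) (by linarith)
  obtain ⟨k, hk1, hk2⟩ := (hfreq.and_eventually (hsub hζ)).exists
  have h4 : (η - ζ) (x k) ≤ ‖η - ζ‖ :=
    (le_abs_self _).trans (((η - ζ).le_opNorm (x k)).trans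
      (mul_le_of_le_one_right (norm_nonneg _) (hx k)))
  rw [dist_eq_norm] at hd'
  rw [ContinuousLinearMap.sub_apply] at h4
  linarith

theorem stmt0 {X : Type*} [NormedAddCommGroup X] [NormedSpace ℝ X] [CompleteSpace X]
    (A : Set (X →L[ℝ] ℝ)) (η : X →L[ℝ] ℝ) :
    List.TFAE
      [ η ∉ Ienv A,
        ∃ x : ℕ → X, (∀ n, ‖x n‖ ≤ 1) ∧
          (⨆ ξ ∈ A, limsup (fun n => ((ξ (x n) : ℝ) : EReal)) atTop) <
            ⨅ n, ((η (x n) : ℝ) : EReal),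
        ∃ x : ℕ → X, (∀ n, ‖x n‖ ≤ 1) ∧
          (⨆ ξ ∈ A, limsup (fun n => ((ξ (x n) : ℝ) : EReal)) atTop) <
            liminf (fun n => ((η (x n) : ℝ) : EReal)) atTop,
        ∃ x : ℕ → X, (∀ n, ‖x n‖ ≤ 1) ∧
          (⨆ ξ ∈ A, limsup (fun n => ((ξ (x n) : ℝ) : EReal)) atTop) <
            limsup (fun n => ((η (x n) : ℝ) : EReal)) atTop ] := by
  tfae_have 1 → 2 := aux_12 A η
  tfae_have 2 → 3 := by
    rintro ⟨x, hx, h⟩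
    exact ⟨x, hx, h.trans_le iInf_le_liminf⟩
  tfae_have 3 → 4 := by
    rintro ⟨x, hx, h⟩
    exact ⟨x, hx, h.trans_le liminf_le_limsup⟩
  tfae_have 4 → 1 := by
    rintro ⟨x, hx, h⟩
    exact aux_41 A η x hx h
  tfae_finish
end

section
/- Let X be a real Banach space and A ⊆ X*. Then the closure of conv(A) in the topology σ(X*,C(X)) is contained in Ienv(A), and Ienv(A) is contained in the closure of conv(A) in the topology σ(X*,B₁(X)). -/
open Filter Topology

open scoped Pointwise

theorem aux_sep_s1 {V F : Type*} [AddCommGroup V] [Module ℝ V] [AddCommGroup F] [Module ℝ F]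
    (B : V →ₗ[ℝ] F →ₗ[ℝ] ℝ) (S : Set (WeakBilin B)) (hS : Convex ℝ S) (x : WeakBilin B)
    (hx : x ∉ closure S) :
    ∃ (y : F) (u : ℝ), (∀ s ∈ S, B s y < u) ∧ u < B x y := by
  obtain ⟨f, u, h1, h2⟩ := geometric_hahn_banach_closed_point hS.closure isClosed_closure hx
  obtain ⟨y, rfl⟩ := LinearMap.dualEmbedding_surjective B f
  exact ⟨y, u, fun s hs => h1 s (subset_closure hs), h2⟩

theorem aux_join {E : Type*} [AddCommGroup E] [Module ℝ E] [TopologicalSpace E]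
    [ContinuousAdd E] [ContinuousSMul ℝ E] {s t : Set E} (hs : IsCompact s) (ht : IsCompact t) :
    IsCompact (convexJoin ℝ s t) := by
  have h : convexJoin ℝ s t =
      (fun p : ℝ × E × E => (1 - p.1) • p.2.1 + p.1 • p.2.2) '' (Set.Icc 0 1 ×ˢ s ×ˢ t) := by
    ext z
    simp only [mem_convexJoin, segment_eq_image, Set.mem_image, Set.mem_prod, Prod.exists]
    constructor
    · rintro ⟨a, ha, b, hb, θ, hθ, rfl⟩
      exact ⟨θ, a, b, ⟨hθ, ha, hb⟩, rfl⟩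
    · rintro ⟨θ, a, b, ⟨hθ, ha, hb⟩, rfl⟩
      exact ⟨a, ha, b, hb, θ, hθ, rfl⟩
  rw [h]
  exact (isCompact_Icc.prod (hs.prod ht)).image (by fun_prop)

theorem aux_compact {E : Type*} [AddCommGroup E] [Module ℝ E] [TopologicalSpace E]
    [ContinuousAdd E] [ContinuousSMul ℝ E] (K : ℕ → Set E) (hK : ∀ n, IsCompact (K n))
    (hc : ∀ n, Convex ℝ (K n)) (n : ℕ) :
    ∃ L : Set E, IsCompact L ∧ Convex ℝ L ∧ (∀ i ≤ n, K i ⊆ L) ∧ L ⊆ convexHull ℝ (⋃ n, K n) := by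
  have hsub : ∀ n, K n ⊆ convexHull ℝ (⋃ n, K n) := fun n =>
    (Set.subset_iUnion K n).trans (subset_convexHull ℝ _)
  induction n with
  | zero => exact ⟨K 0, hK 0, hc 0, fun i hi => by simp_all, hsub 0⟩
  | succ n ih =>
    obtain ⟨L, h1, h2, h3, h4⟩ := ih
    rcases L.eq_empty_or_nonempty with he | hne
    · refine ⟨K (n+1), hK _, hc _, fun i hi => ?_, hsub _⟩
      rcases Nat.le_succ_iff.1 hi with h | h
      · have := h3 i h
        rw [he] at this
        exact this.trans (Set.empty_subset _)
      · rw [h]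
    rcases (K (n+1)).eq_empty_or_nonempty with he' | hne'
    · refine ⟨L, h1, h2, fun i hi => ?_, h4⟩
      rcases Nat.le_succ_iff.1 hi with h | h
      · exact h3 i h
      · rw [h, Nat.succ_eq_add_one, he']; exact Set.empty_subset _
    refine ⟨convexJoin ℝ L (K (n+1)), aux_join h1 (hK _), h2.convexJoin (hc _), fun i hi => ?_,
      (convexJoin_subset_convexHull _ _).trans (convexHull_min (Set.union_subset h4 (hsub _)) (convex_convexHull ℝ _))⟩
    rcases Nat.le_succ_iff.1 hi with h | h
    · exact (h3 i h).trans (subset_convexJoin_left hne')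
    · rw [h]; exact subset_convexJoin_right hne

theorem aux_point {X : Type*} [NormedAddCommGroup X] [NormedSpace ℝ X]
    (L : Set (WeakDual ℝ X)) (hL : IsCompact L) (hc : Convex ℝ L)
    (F : (X →L[ℝ] ℝ) →L[ℝ] ℝ) (η : X →L[ℝ] ℝ) (δ : ℝ) (hδ : 0 < δ)
    (h : ∀ l : X →L[ℝ] ℝ, StrongDual.toWeakDual l ∈ L → F l + δ * (‖F‖ + 1) ≤ F η) :
    ∃ x : X, ‖x‖ ≤ 1 ∧ ∀ l : X →L[ℝ] ℝ, StrongDual.toWeakDual l ∈ L → l x + δ ≤ η x := by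
  rcases L.eq_empty_or_nonempty with he | ⟨l0, hl0⟩
  · exact ⟨0, by simp, by simp [he]⟩
  set D : Set (WeakDual ℝ X) :=
    WeakDual.toStrongDual ⁻¹' Metric.closedBall (0 : StrongDual ℝ X) δ with hD
  have hDc : IsCompact D := WeakDual.isCompact_closedBall 0 δ
  have hDconv : Convex ℝ D :=
    (convex_closedBall (0 : StrongDual ℝ X) δ).linear_preimage
      (WeakDual.toStrongDual (𝕜 := ℝ) (E := X)).toLinearMap
  have hLD : IsCompact (L + D) := hL.add hDc
  have hη : StrongDual.toWeakDual η ∉ closure (L + D) := by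
    rw [hLD.isClosed.closure_eq]
    rintro ⟨l, hl, b, hb, hlb⟩
    have h1 := h (WeakDual.toStrongDual l) hl
    have h2 : ‖WeakDual.toStrongDual b‖ ≤ δ := by simpa [hD] using hb
    have h3 : η = WeakDual.toStrongDual l + WeakDual.toStrongDual b := by
      rw [← map_add]; exact hlb.symm
    have h4 : F (WeakDual.toStrongDual b) ≤ ‖F‖ * δ :=
      (le_abs_self _).trans ((F.le_opNorm _).trans (by gcongr))
    rw [h3, map_add] at h1
    nlinarith
  obtain ⟨x, u, h1, h2⟩ := aux_sep_s1 (topDualPairing ℝ X) (L + D) (hc.add hDconv)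
    (StrongDual.toWeakDual η) hη
  have key : ∀ l : X →L[ℝ] ℝ, StrongDual.toWeakDual l ∈ L → l x + δ * ‖x‖ < η x := by
    intro l hl
    obtain ⟨g, hg, hgx⟩ := exists_dual_vector'' ℝ x
    have hm : StrongDual.toWeakDual l + StrongDual.toWeakDual (δ • g) ∈ L + D := by
      refine Set.add_mem_add hl ?_
      have : ‖δ • g‖ ≤ δ := by
        rw [norm_smul, Real.norm_of_nonneg hδ.le]
        nlinarith
      simpa [hD] using this
    have h3 : l x + δ * g x < u := h1 _ hm
    have h4 : u < η x := h2
    have h5 : g x = ‖x‖ := by simpa using hgx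
    rw [h5] at h3
    linarith
  have hx : 0 < ‖x‖ := by
    rw [norm_pos_iff]
    rintro rfl
    have := key (WeakDual.toStrongDual l0) hl0
    simp at this
  refine ⟨‖x‖⁻¹ • x, ?_, fun l hl => ?_⟩
  · rw [norm_smul, norm_inv, norm_norm, inv_mul_cancel₀ hx.ne']
  · have := key l hl
    rw [map_smul, map_smul, smul_eq_mul, smul_eq_mul]
    have h6 : δ = ‖x‖⁻¹ * (δ * ‖x‖) := by field_simp
    have h7 : ‖x‖⁻¹ * (l x + δ * ‖x‖) ≤ ‖x‖⁻¹ * η x := by gcongr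
    rw [mul_add, ← h6] at h7
    exact h7

theorem aux_cluster {X : Type*} [NormedAddCommGroup X] [NormedSpace ℝ X]
    (x : ℕ → X) (hx : ∀ n, ‖x n‖ ≤ 1) :
    ∃ G ∈ CX X, ∀ ξ : X →L[ℝ] ℝ,
      Tendsto (fun n => ξ (x n)) (Filter.hyperfilter ℕ : Filter ℕ) (𝓝 (G ξ)) := by
  set J : ℕ → WeakDual ℝ (X →L[ℝ] ℝ) := fun n =>
    StrongDual.toWeakDual (NormedSpace.inclusionInDoubleDual ℝ X (x n)) with hJ
  have hc := WeakDual.isCompact_closedBall (𝕜 := ℝ) (0 : StrongDual ℝ (X →L[ℝ] ℝ)) 1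
  obtain ⟨G, -, hG⟩ := hc.ultrafilter_le_nhds ((Filter.hyperfilter ℕ).map J) (by
    rw [le_principal_iff]
    refine Filter.mem_map.2 (Filter.univ_mem' fun n => ?_)
    have : ‖NormedSpace.inclusionInDoubleDual ℝ X (x n)‖ ≤ 1 :=
      (NormedSpace.double_dual_bound ℝ X (x n)).trans (hx n)
    simpa [hJ] using this)
  have hG' : Tendsto J (Filter.hyperfilter ℕ : Filter ℕ) (𝓝 G) := hG
  refine ⟨WeakDual.toStrongDual G, ⟨Set.range x, Set.countable_range x, ?_⟩, fun ξ => ?_⟩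
  · have hmem : G ∈ closure (Set.range J) :=
      mem_closure_of_tendsto hG' (Filter.univ_mem' fun n => ⟨n, rfl⟩)
    have hr : (fun x => NormedSpace.inclusionInDoubleDual ℝ X x) '' Set.range x = Set.range J :=
      (Set.range_comp _ _).symm
    rw [hr]
    exact hmem
  · exact ((WeakDual.eval_continuous ξ).tendsto G).comp hG'

theorem aux_sigma {X : Type*} [NormedAddCommGroup X] [NormedSpace ℝ X]
    (Y : Set ((X →L[ℝ] ℝ) →L[ℝ] ℝ)) (G) (hG : G ∈ Y) (A : Set (X →L[ℝ] ℝ)) (c : ℝ)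
    (hA : ∀ a ∈ A, G a ≤ c) :
    ∀ a ∈ @closure _ (sigmaTop Y) (convexHull ℝ A), G a ≤ c := by
  have hcont : @Continuous _ _ (sigmaTop Y) _ (fun a => G a) := by
    have h1 : @Continuous _ _ (sigmaTop Y) _
        (fun (f : X →L[ℝ] ℝ) (y : Y) => (y : (X →L[ℝ] ℝ) →L[ℝ] ℝ) f) :=
      continuous_induced_dom
    exact (@continuous_pi_iff _ _ _ (sigmaTop Y) _ _).1 h1 ⟨G, hG⟩
  have hcl : @IsClosed _ (sigmaTop Y) {a | G a ≤ c} := by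
    let _ := sigmaTop Y
    exact isClosed_le hcont continuous_const
  have hcv : convexHull ℝ A ⊆ {a | G a ≤ c} :=
    convexHull_min hA (convex_halfSpace_le G.toLinearMap.isLinear c)
  exact @closure_minimal _ (sigmaTop Y) _ _ hcv hcl

theorem aux_part1 {X : Type*} [NormedAddCommGroup X] [NormedSpace ℝ X]
    (A : Set (X →L[ℝ] ℝ)) :
    @closure _ (sigmaTop (CX X)) (convexHull ℝ A) ⊆ Ienv A := by
  intro η hη
  by_contra hne
  simp only [Ienv, Set.mem_iInter, not_forall] at hne
  obtain ⟨As, hAs, hne⟩ := hne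
  -- refine to bounded pieces
  set Bs : ℕ → Set (X →L[ℝ] ℝ) := fun k =>
    As k.unpair.1 ∩ Metric.closedBall 0 (k.unpair.2 : ℝ) with hBs
  set K : ℕ → Set (WeakDual ℝ X) := fun k => wstarClosure (convexHull ℝ (Bs k)) with hK
  have hconvK : ∀ k, Convex ℝ (K k) := fun k =>
    Convex.closure (𝕜 := ℝ) (E := WeakDual ℝ X) (convex_convexHull ℝ (Bs k))
  have hcompK : ∀ k, IsCompact (K k) := by
    intro k
    have hc := WeakDual.isCompact_closedBall (𝕜 := ℝ) (0 : StrongDual ℝ X) (k.unpair.2 : ℝ)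
    have hsub : closure (convexHull ℝ (Bs k) : Set (WeakDual ℝ X)) ⊆
        WeakDual.toStrongDual ⁻¹' Metric.closedBall (0 : StrongDual ℝ X) (k.unpair.2 : ℝ) := by
      refine closure_minimal ?_ hc.isClosed
      exact convexHull_min Set.inter_subset_right (convex_closedBall (0 : StrongDual ℝ X) _)
    have hcc : IsCompact (closure (convexHull ℝ (Bs k) : Set (WeakDual ℝ X))) :=
      hc.of_isClosed_subset isClosed_closure hsub
    exact hcc
  have hKsub : ∀ k, K k ⊆ wstarClosure (convexHull ℝ (As k.unpair.1)) := fun k =>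
    @closure_mono _ (wstarTop X) _ _ (convexHull_mono Set.inter_subset_left)
  obtain ⟨F, u, hF1, hF2⟩ := geometric_hahn_banach_closed_point
    (convex_convexHull ℝ _).closure isClosed_closure hne
  set δ : ℝ := (F η - u) / (‖F‖ + 1) with hδ
  have hpos : 0 < ‖F‖ + 1 := by positivity
  have hδ0 : 0 < δ := div_pos (by linarith) hpos
  have hδe : δ * (‖F‖ + 1) = F η - u := by rw [hδ]; field_simp
  choose L hL1 hL2 hL3 hL4 using aux_compact K hcompK hconvK
  have hLF : ∀ n, ∀ l : X →L[ℝ] ℝ, StrongDual.toWeakDual l ∈ L n →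
      F l + δ * (‖F‖ + 1) ≤ F η := by
    intro n l hl
    have h1 : l ∈ convexHull ℝ (⋃ n, wstarClosure (convexHull ℝ (As n))) := by
      have h2 := hL4 n hl
      refine convexHull_mono ?_ h2
      exact Set.iUnion_subset fun k => (hKsub k).trans
        (Set.subset_iUnion (fun n => wstarClosure (convexHull ℝ (As n))) k.unpair.1)
    have := hF1 l (subset_closure h1)
    linarith
  choose x hx1 hx2 using fun n => aux_point (L n) (hL1 n) (hL2 n) F η δ hδ0 (hLF n)
  obtain ⟨G, hG, hlim⟩ := aux_cluster x hx1
  have hGA : ∀ a ∈ A, G a ≤ G η - δ := by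
    intro a ha
    rw [hAs] at ha
    obtain ⟨n, hn⟩ := Set.mem_iUnion.1 ha
    obtain ⟨m, hm⟩ := exists_nat_ge ‖a‖
    have haB : a ∈ Bs (Nat.pair n m) := by
      simp only [hBs, Nat.unpair_pair]
      exact ⟨hn, by simpa using hm⟩
    have haK : StrongDual.toWeakDual a ∈ K (Nat.pair n m) :=
      @subset_closure _ (wstarTop X) _ _ (subset_convexHull ℝ _ haB)
    refine le_of_tendsto_of_tendsto (hlim a) ((hlim η).sub_const δ) ?_
    have hev : ∀ᶠ k in atTop, a (x k) ≤ η (x k) - δ := by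
      filter_upwards [eventually_ge_atTop (Nat.pair n m)] with k hk
      have := hx2 k a (hL3 k _ hk haK)
      linarith
    rw [← Nat.cofinite_eq_atTop] at hev
    exact Filter.hyperfilter_le_cofinite hev
  have := aux_sigma (CX X) G hG A _ hGA η hη
  linarith

noncomputable def B1sub (X : Type*) [NormedAddCommGroup X] [NormedSpace ℝ X] :
    Submodule ℝ ((X →L[ℝ] ℝ) →L[ℝ] ℝ) where
  carrier := B1 X
  zero_mem' := ⟨0, fun ξ => by simp⟩
  add_mem' := by
    rintro F G ⟨x, hx⟩ ⟨y, hy⟩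
    exact ⟨x + y, fun ξ => by simpa using (hx ξ).add (hy ξ)⟩
  smul_mem' := by
    rintro c F ⟨x, hx⟩
    exact ⟨c • x, fun ξ => by simpa using (hx ξ).const_mul c⟩

noncomputable abbrev B1grp (X : Type*) [NormedAddCommGroup X] [NormedSpace ℝ X] :
    AddCommGroup (B1sub X) := Module.addCommMonoidToAddCommGroup ℝ

noncomputable def B1pair (X : Type*) [NormedAddCommGroup X] [NormedSpace ℝ X] :
    (X →L[ℝ] ℝ) →ₗ[ℝ] (B1sub X) →ₗ[ℝ] ℝ :=
  LinearMap.mk₂ ℝ (fun ξ F => (F : (X →L[ℝ] ℝ) →L[ℝ] ℝ) ξ)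
    (by intros; simp) (by intros; simp) (by intros; simp) (by intros; simp)

theorem aux_part2 {X : Type*} [NormedAddCommGroup X] [NormedSpace ℝ X]
    (A : Set (X →L[ℝ] ℝ)) :
    Ienv A ⊆ @closure _ (sigmaTop (B1 X)) (convexHull ℝ A) := by
  intro η hη
  by_contra hne
  obtain ⟨⟨F, x, hx⟩, u, h1, h2⟩ := @aux_sep_s1 (X →L[ℝ] ℝ) (B1sub X) _ _ (B1grp X) (B1sub X).module (B1pair X) (convexHull ℝ A) 
    (convex_convexHull ℝ A) η hne
  replace h1 : ∀ a ∈ A, F a < u := fun a ha => h1 a (subset_convexHull ℝ A ha)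
  replace h2 : u < F η := h2
  set As : ℕ → Set (X →L[ℝ] ℝ) := fun n => {a ∈ A | ∀ m ≥ n, a (x m) ≤ u} with hAs
  have hU : A = ⋃ n, As n := by
    ext a
    simp only [hAs, Set.mem_iUnion, Set.mem_setOf_eq, exists_and_left, iff_self_and]
    intro ha
    exact eventually_atTop.1 ((hx a).eventually_le_const (h1 a ha))
  simp only [Ienv, Set.mem_iInter] at hη
  have hm := hη As hU
  have hsub : closure (convexHull ℝ (⋃ n, wstarClosure (convexHull ℝ (As n)))) ⊆
      {ξ | F ξ ≤ u} := by
    refine closure_minimal (convexHull_min (Set.iUnion_subset fun n => ?_)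
      (convex_halfSpace_le F.toLinearMap.isLinear u)) (isClosed_le F.continuous continuous_const)
    have hw : ∀ m ≥ n, wstarClosure (convexHull ℝ (As n)) ⊆ {ξ | ξ (x m) ≤ u} := by
      intro m hm
      have hcl0 : IsClosed {ξ : WeakDual ℝ X | ξ (x m) ≤ u} :=
        isClosed_le (WeakDual.eval_continuous (𝕜 := ℝ) (x m)) continuous_const
      have hcl : @IsClosed _ (wstarTop X) {ξ : X →L[ℝ] ℝ | ξ (x m) ≤ u} := hcl0
      refine @closure_minimal _ (wstarTop X) _ _ (convexHull_min (fun a ha => ha.2 m hm) ?_) hcl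
      intro a ha b hb s t hs ht hst
      simp only [Set.mem_setOf_eq] at ha hb
      simp only [Set.mem_setOf_eq, ContinuousLinearMap.add_apply, ContinuousLinearMap.smul_apply,
        smul_eq_mul]
      have : u = s * u + t * u := by rw [← add_mul, hst, one_mul]
      rw [this]
      gcongr
    intro ξ hξ
    exact le_of_tendsto (hx ξ) (eventually_atTop.2 ⟨n, fun m hm => hw m hm hξ⟩)
  exact absurd (hsub hm) (not_le.2 h2)

theorem stmt1 {X : Type*} [NormedAddCommGroup X] [NormedSpace ℝ X] [CompleteSpace X]
    (A : Set (X →L[ℝ] ℝ)) :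
    @closure _ (sigmaTop (CX X)) (convexHull ℝ A) ⊆ Ienv A ∧
      Ienv A ⊆ @closure _ (sigmaTop (B1 X)) (convexHull ℝ A) := by
  exact ⟨aux_part1 A, aux_part2 A⟩
end

section
/- Let X be a real Banach space and x** ∈ X** an element of the bidual, and let ker x** = { ξ ∈ X* : x**(ξ) = 0 }. If x** ∈ B₁(X) then Ienv(ker x**) = ker x**, and if x** ∉ B₁(X) then Ienv(ker x**) = X*. -/
open Filter Topology

theorem aux_compact_s3 {E : Type*} [AddCommGroup E] [Module ℝ E] [TopologicalSpace E]
    [IsTopologicalAddGroup E] [ContinuousSMul ℝ E] {s t : Set E} (hs : IsCompact s)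
    (ht : IsCompact t) (hsc : Convex ℝ s) (htc : Convex ℝ t) :
    IsCompact (convexHull ℝ (s ∪ t)) := by
  rcases s.eq_empty_or_nonempty with rfl | hs0
  · simpa [htc.convexHull_eq] using ht
  rcases t.eq_empty_or_nonempty with rfl | ht0
  · simpa [hsc.convexHull_eq] using hs
  rw [hsc.convexHull_union htc hs0 ht0]
  have : convexJoin ℝ s t =
      (fun p : ℝ × E × E => (1 - p.1) • p.2.1 + p.1 • p.2.2) '' (Set.Icc (0:ℝ) 1 ×ˢ (s ×ˢ t)) := by
    ext x
    simp only [mem_convexJoin, segment_eq_image, Set.mem_image, Set.mem_prod, Prod.exists]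
    constructor
    · rintro ⟨a, ha, b, hb, θ, hθ, rfl⟩
      exact ⟨θ, a, b, ⟨hθ, ha, hb⟩, rfl⟩
    · rintro ⟨θ, a, b, ⟨hθ, ha, hb⟩, rfl⟩
      exact ⟨a, ha, b, hb, θ, hθ, rfl⟩
  rw [this]
  exact (isCompact_Icc.prod (hs.prod ht)).image (by fun_prop)

theorem aux_seq {E : Type*} [AddCommGroup E] [Module ℝ E] [TopologicalSpace E]
    [IsTopologicalAddGroup E] [ContinuousSMul ℝ E] (P : ℕ → Set E) (hP : ∀ n, IsCompact (P n))
    (hPc : ∀ n, Convex ℝ (P n)) (H : Set E) (hH : Convex ℝ H) (h0 : (0:E) ∈ H)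
    (hPH : ∀ n, P n ⊆ H) :
    ∃ D : ℕ → Set E, Monotone D ∧ (∀ n, IsCompact (D n) ∧ Convex ℝ (D n) ∧ D n ⊆ H ∧
      (0:E) ∈ D n ∧ P n ⊆ D (n+1)) := by
  let D : ℕ → Set E := fun n => Nat.rec {0} (fun n s => convexHull ℝ (s ∪ P n)) n
  have hD : ∀ n, D (n+1) = convexHull ℝ (D n ∪ P n) := fun n => rfl
  have hm : ∀ n, D n ⊆ D (n+1) := fun n => by
    rw [hD]; exact Set.subset_union_left.trans (subset_convexHull ℝ _)
  have hp : ∀ n, P n ⊆ D (n+1) := fun n => by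
    rw [hD]; exact Set.subset_union_right.trans (subset_convexHull ℝ _)
  have hc : ∀ n, Convex ℝ (D n) := fun n => by
    cases n with
    | zero => exact convex_singleton 0
    | succ n => rw [hD]; exact convex_convexHull ℝ _
  refine ⟨D, monotone_nat_of_le_succ hm, fun n => ?_⟩
  refine ⟨?_, hc n, ?_, ?_, hp n⟩
  · induction n with
    | zero => exact isCompact_singleton
    | succ n ih => rw [hD]; exact aux_compact_s3 ih (hP n) (hc n) (hPc n)
  · induction n with
    | zero => exact Set.singleton_subset_iff.2 h0
    | succ n ih => rw [hD]; exact convexHull_min (Set.union_subset ih (hPH n)) hH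
  · induction n with
    | zero => exact Set.mem_singleton _
    | succ n ih => exact hm n ih

theorem aux_eval {X : Type*} [NormedAddCommGroup X] [NormedSpace ℝ X]
    (f : StrongDual ℝ (WeakDual ℝ X)) : ∃ y : X, ∀ ξ : WeakDual ℝ X, f ξ = ξ y := by
  obtain ⟨y, hy⟩ := LinearMap.dualEmbedding_surjective (topDualPairing ℝ X) f
  exact ⟨y, fun ξ => by rw [← hy]; rfl⟩

theorem aux_sep_s3 {X : Type*} [NormedAddCommGroup X] [NormedSpace ℝ X]
    (S : Set (WeakDual ℝ X)) (hS : IsCompact S) (hc : Convex ℝ S) (h0 : 0 ∈ S)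
    (c : ℝ) (hcp : 0 < c) (η : WeakDual ℝ X) (hη : c • η ∉ S) :
    ∃ x : X, η x = 1 ∧ ∀ ξ ∈ S, ξ x ≤ c := by
  have : LocallyConvexSpace ℝ (WeakDual ℝ X) :=
    inferInstanceAs (LocallyConvexSpace ℝ (WeakBilin (topDualPairing ℝ X)))
  obtain ⟨f, u, h1, h2⟩ := geometric_hahn_banach_closed_point hc hS.isClosed hη
  obtain ⟨y, hy⟩ := aux_eval f
  have hu : 0 < u := by simpa using h1 0 h0
  rw [map_smul, hy, smul_eq_mul] at h2
  have hpos : 0 < η y := by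
    by_contra h
    nlinarith [not_lt.1 h]
  refine ⟨(η y)⁻¹ • y, ?_, fun ξ hξ => ?_⟩
  · rw [map_smul, smul_eq_mul, inv_mul_cancel₀ hpos.ne']
  · have := h1 ξ hξ
    rw [hy] at this
    rw [map_smul, smul_eq_mul, inv_mul_le_iff₀ hpos]
    linarith

theorem aux_core {X : Type*} [NormedAddCommGroup X] [NormedSpace ℝ X]
    (F : (X →L[ℝ] ℝ) →L[ℝ] ℝ) (η : X →L[ℝ] ℝ) (hη : F η = 1) (c : ℝ) (hc : 0 < c)
    (B : ℕ → Set (WeakDual ℝ X)) (hB : ∀ n, IsClosed (B n)) (hBc : ∀ n, Convex ℝ (B n))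
    (hK : ∀ ξ : X →L[ℝ] ℝ, F ξ = 0 → ∃ n, StrongDual.toWeakDual ξ ∈ B n)
    (hF : ∀ n, ∀ ξ ∈ B n, F (WeakDual.toStrongDual ξ) ≤ c) : F ∈ B1 X := by
  let L : WeakDual ℝ X →ₗ[ℝ] ℝ := F.toLinearMap ∘ₗ WeakDual.toStrongDual.toLinearMap
  let P : ℕ → Set (WeakDual ℝ X) := fun n => B n.unpair.1 ∩
    WeakDual.toStrongDual ⁻¹' Metric.closedBall 0 (n.unpair.2 : ℝ)
  have hPc : ∀ n, IsCompact (P n) := fun n =>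
    (WeakDual.isCompact_closedBall 0 _).inter_left (hB _)
  have hPv : ∀ n, Convex ℝ (P n) := fun n => (hBc _).inter
    ((convex_closedBall (0 : StrongDual ℝ X) (n.unpair.2 : ℝ)).linear_preimage
      (WeakDual.toStrongDual (𝕜 := ℝ) (E := X)).toLinearMap)
  obtain ⟨D, hD, h⟩ := aux_seq P hPc hPv {ξ | L ξ ≤ c}
    (convex_halfSpace_le L.isLinear c) (by simpa using hc.le) (fun n ξ hξ => hF _ ξ hξ.1)
  choose hDc hDv hDH hD0 hPD using h
  have hev : ∀ ξ : X →L[ℝ] ℝ, F ξ = 0 → ∀ᶠ n in atTop, StrongDual.toWeakDual ξ ∈ D n := by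
    intro ξ hξ
    obtain ⟨k, hk⟩ := hK ξ hξ
    obtain ⟨r, hr⟩ := exists_nat_ge ‖ξ‖
    filter_upwards [eventually_ge_atTop (Nat.pair k r + 1)] with n hn
    refine hD hn (hPD _ ⟨by simpa using hk, ?_⟩)
    simpa using hr
  let S : ℕ → Set (WeakDual ℝ X) := fun n => D n ∩ (-(LinearMap.id : WeakDual ℝ X →ₗ[ℝ] WeakDual ℝ X)) ⁻¹' D n
  have hS : ∀ n, ∃ x : X, η x = 1 ∧ ∀ ξ ∈ S n, ξ x ≤ 2 * c := by
    intro n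
    refine aux_sep_s3 (S n) ?_ ((hDv n).inter ((hDv n).linear_preimage _)) ?_ (2*c) (by linarith)
      (StrongDual.toWeakDual η) ?_
    · exact (hDc n).inter_right ((hDc n).isClosed.preimage continuous_neg)
    · exact ⟨hD0 n, by simpa using hD0 n⟩
    · intro hmem
      have h3 : L ((2*c) • StrongDual.toWeakDual η) ≤ c := hDH n hmem.1
      have h4 : L (StrongDual.toWeakDual η) = 1 := hη
      rw [map_smul, h4, smul_eq_mul] at h3
      linarith
  choose x hx1 hx2 using hS
  have hx0 : ∀ ξ : X →L[ℝ] ℝ, F ξ = 0 → Tendsto (fun n => ξ (x n)) atTop (𝓝 0) := by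
    intro ξ hξ
    rw [Metric.tendsto_nhds]
    intro ε hε
    obtain ⟨m, hm⟩ := exists_nat_gt (2 * c / ε)
    have hm0 : (0:ℝ) < m := lt_of_le_of_lt (by positivity) hm
    have e1 := hev ((m:ℝ) • ξ) (by simp [hξ])
    have e2 := hev (-((m:ℝ) • ξ)) (by simp [hξ])
    filter_upwards [e1, e2] with n h1 h2
    have a1 : (m:ℝ) * ξ (x n) ≤ 2 * c := hx2 n (StrongDual.toWeakDual ((m:ℝ) • ξ)) ⟨h1, h2⟩
    have a2 : -((m:ℝ) * ξ (x n)) ≤ 2 * c := hx2 n (StrongDual.toWeakDual (-((m:ℝ) • ξ)))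
      ⟨h2, by
        have : (-(LinearMap.id : WeakDual ℝ X →ₗ[ℝ] WeakDual ℝ X))
          (StrongDual.toWeakDual (-((m:ℝ) • ξ))) = StrongDual.toWeakDual ((m:ℝ) • ξ) := by simp
        rw [Set.mem_preimage, this]; exact h1⟩
    rw [div_lt_iff₀ hε] at hm
    rw [Real.dist_eq, sub_zero, abs_lt]
    constructor
    · by_contra hh
      nlinarith [not_lt.1 hh]
    · by_contra hh
      nlinarith [not_lt.1 hh]
  refine ⟨x, fun ξ => ?_⟩
  have := (hx0 (ξ - F ξ • η) (by simp [hη])).add_const (F ξ)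
  simpa [hx1] using this

theorem aux_closure {X : Type*} [NormedAddCommGroup X] [NormedSpace ℝ X]
    (A : Set (X →L[ℝ] ℝ)) :
    wstarClosure A = StrongDual.toWeakDual ⁻¹' closure (WeakDual.toStrongDual ⁻¹' A) := rfl

theorem stmt3 {X : Type*} [NormedAddCommGroup X] [NormedSpace ℝ X] [CompleteSpace X]
    (F : (X →L[ℝ] ℝ) →L[ℝ] ℝ) :
    (F ∈ B1 X → Ienv {ξ : X →L[ℝ] ℝ | F ξ = 0} = {ξ : X →L[ℝ] ℝ | F ξ = 0}) ∧
      (F ∉ B1 X → Ienv {ξ : X →L[ℝ] ℝ | F ξ = 0} = Set.univ) := by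
  have hsub : ∀ As : ℕ → Set (X →L[ℝ] ℝ), {ξ : X →L[ℝ] ℝ | F ξ = 0} = ⋃ n, As n →
      {ξ : X →L[ℝ] ℝ | F ξ = 0} ⊆
        closure (convexHull ℝ (⋃ n, wstarClosure (convexHull ℝ (As n)))) := by
    intro As hAs
    rw [hAs]
    refine Set.Subset.trans (Set.iUnion_mono fun n => ?_)
      ((subset_convexHull ℝ _).trans subset_closure)
    exact (subset_convexHull ℝ _).trans (@subset_closure _ (wstarTop X) _)
  constructor
  · rintro ⟨x, hx⟩
    apply Set.Subset.antisymm
    · intro ξ hξ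
      have key : ∀ ε > 0, |F ξ| ≤ ε := by
        intro ε hε
        let As : ℕ → Set (X →L[ℝ] ℝ) := fun n => {ζ | F ζ = 0 ∧ ∀ m ≥ n, ζ (x m) ∈ Set.Icc (-ε) ε}
        have hAs : {ζ : X →L[ℝ] ℝ | F ζ = 0} = ⋃ n, As n := by
          ext ζ
          simp only [Set.mem_iUnion]
          constructor
          · intro (h : F ζ = 0)
            have := hx ζ
            rw [h] at this
            obtain ⟨n, hn⟩ := eventually_atTop.1
              (this.eventually (Icc_mem_nhds (neg_lt_zero.2 hε) hε))
            exact ⟨n, h, hn⟩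
          · rintro ⟨n, h, _⟩
            exact h
        have h1 := Set.mem_iInter₂.1 hξ As hAs
        have h2 : closure (convexHull ℝ (⋃ n, wstarClosure (convexHull ℝ (As n)))) ⊆
            F ⁻¹' Set.Icc (-ε) ε := by
          refine closure_minimal (convexHull_min (Set.iUnion_subset fun n => ?_)
            ((convex_Icc _ _).linear_preimage F.toLinearMap)) (isClosed_Icc.preimage F.continuous)
          have h3 : wstarClosure (convexHull ℝ (As n)) ⊆
              {ζ | ∀ m ≥ n, ζ (x m) ∈ Set.Icc (-ε) ε} := by
            rw [aux_closure]
            have : closure (WeakDual.toStrongDual ⁻¹' (convexHull ℝ (As n))) ⊆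
                {ζ : WeakDual ℝ X | ∀ m ≥ n, ζ (x m) ∈ Set.Icc (-ε) ε} := by
              apply closure_minimal
              · intro ζ hζ
                have h4 : convexHull ℝ (As n) ⊆
                  {ζ : X →L[ℝ] ℝ | ∀ m ≥ n, ζ (x m) ∈ Set.Icc (-ε) ε} := by
                  apply convexHull_min
                  · exact fun ζ h => h.2
                  · intro a ha b hb s t hs ht hst m hm
                    have := (convex_Icc (-ε) ε) (ha m hm) (hb m hm) hs ht hst
                    simpa using this
                exact h4 hζ
              · have : {ζ : WeakDual ℝ X | ∀ m ≥ n, ζ (x m) ∈ Set.Icc (-ε) ε} =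
                  ⋂ m, ⋂ (_ : m ≥ n), (fun ζ : WeakDual ℝ X => ζ (x m)) ⁻¹' Set.Icc (-ε) ε := by
                  ext; simp
                rw [this]
                exact isClosed_iInter fun m => isClosed_iInter fun _ =>
                  isClosed_Icc.preimage (WeakDual.eval_continuous _)
            exact fun ζ hζ => this hζ
          intro ζ hζ
          exact isClosed_Icc.mem_of_tendsto (hx ζ)
            (eventually_atTop.2 ⟨n, h3 hζ⟩)
        exact abs_le.2 (h2 h1)
      have : |F ξ| ≤ 0 := le_of_forall_pos_le_add fun ε hε => by simpa using key ε hε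
      exact abs_nonpos_iff.1 this
    · exact Set.subset_iInter₂ hsub
  · intro hF
    rw [Set.eq_univ_iff_forall]
    intro ξ₀
    refine Set.mem_iInter₂.2 fun As hAs => ?_
    by_contra hξ₀
    apply hF
    obtain ⟨G, u, hG1, hG2⟩ := geometric_hahn_banach_closed_point
      (convex_convexHull ℝ _).closure isClosed_closure hξ₀
    have hu : 0 < u := by
      simpa using hG1 0 (hsub As hAs (by simp))
    have hker : ∀ ζ, F ζ = 0 → G ζ = 0 := by
      intro ζ hζ
      by_contra hne
      have := hG1 ((u / G ζ) • ζ) (hsub As hAs (by simp [hζ]))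
      rw [map_smul, smul_eq_mul, div_mul_cancel₀ _ hne] at this
      exact lt_irrefl _ this
    have hG0 : 0 < G ξ₀ := hu.trans hG2
    have hF0 : F ξ₀ ≠ 0 := fun h => hG0.ne' (hker _ h)
    have hGF : ∀ ζ, G ζ = F ζ * (G ξ₀ / F ξ₀) := by
      intro ζ
      have := hker (ζ - (F ζ / F ξ₀) • ξ₀) (by simp [hF0])
      rw [map_sub, map_smul, smul_eq_mul, sub_eq_zero] at this
      rw [this]; ring
    have hG : G ∈ B1 X := by
      refine aux_core G ((G ξ₀)⁻¹ • ξ₀) (by simp [hG0.ne']) u hu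
        (fun n => closure (WeakDual.toStrongDual ⁻¹' (convexHull ℝ (As n))))
        (fun n => isClosed_closure)
        (fun n => ((convex_convexHull ℝ (As n)).linear_preimage
          (WeakDual.toStrongDual (𝕜 := ℝ) (E := X)).toLinearMap).closure) ?_ ?_
      · intro ζ hζ
        have h0 : F ζ = 0 := by
          have := hGF ζ
          rw [hζ] at this
          rcases mul_eq_zero.1 this.symm with h | h
          · exact h
          · exact absurd h (div_ne_zero hG0.ne' hF0)
        have h1 : ζ ∈ ⋃ n, As n := hAs ▸ h0
        obtain ⟨n, hn⟩ := Set.mem_iUnion.1 h1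
        have h2 : ζ ∈ convexHull ℝ (As n) := subset_convexHull ℝ _ hn
        exact ⟨n, subset_closure h2⟩
      · intro n ζ hζ
        refine (hG1 _ (subset_closure (subset_convexHull ℝ _ (Set.mem_iUnion.2 ⟨n, ?_⟩)))).le
        rw [aux_closure]
        exact hζ
    obtain ⟨x, hx⟩ := hG
    refine ⟨fun n => (F ξ₀ / G ξ₀) • x n, fun ζ => ?_⟩
    have := (hx ζ).const_mul (F ξ₀ / G ξ₀)
    have e : F ξ₀ / G ξ₀ * G ζ = F ζ := by
      rw [hGF ζ]; field_simp
    rw [e] at this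
    simpa using this
end

section
/- Let X be a real Banach space. The following are equivalent: (1) there is a locally convex topology τ on X* (a topology making X* a locally convex topological vector space over ℝ) such that Ienv(A) equals the τ-closure of conv(A) for every A ⊆ X*; (2) Ienv(A) equals the closure of conv(A) in the topology σ(X*,B₁(X)) for every A ⊆ X*. -/
open Filter Topology

lemma cpt_hull {V : Type*} [AddCommGroup V] [Module ℝ V] [TopologicalSpace V]
    [IsTopologicalAddGroup V] [ContinuousSMul ℝ V] (S : Set V) (hS : Convex ℝ S)
    (Q : ℕ → Set V) (hc : ∀ i, IsCompact (Q i)) (hv : ∀ i, Convex ℝ (Q i)) (hQ : ∀ i, Q i ⊆ S)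
    (n : ℕ) : ∃ D, IsCompact D ∧ Convex ℝ D ∧ D ⊆ S ∧ ∀ i < n, Q i ⊆ D := by
  induction n with
  | zero => exact ⟨∅, isCompact_empty, convex_empty, by simp, by simp⟩
  | succ n ih =>
    obtain ⟨D, h1, h2, h3, h4⟩ := ih
    refine ⟨convexHull ℝ (D ∪ Q n), ?_, convex_convexHull _ _,
      convexHull_min (Set.union_subset h3 (hQ n)) hS, ?_⟩
    · rcases D.eq_empty_or_nonempty with rfl | hD
      · simpa [(hv n).convexHull_eq] using hc n
      rcases (Q n).eq_empty_or_nonempty with h0 | h0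
      · simpa [h0, h2.convexHull_eq] using h1
      rw [h2.convexHull_union (hv n) hD h0]
      have : convexJoin ℝ D (Q n) = (fun p : ℝ × V × V => (1 - p.1) • p.2.1 + p.1 • p.2.2) ''
          (Set.Icc (0:ℝ) 1 ×ˢ (D ×ˢ Q n)) := by
        ext z
        simp only [mem_convexJoin, segment_eq_image, Set.mem_image, Set.mem_prod, Prod.exists]
        constructor
        · rintro ⟨a, ha, b, hb, t, ht, rfl⟩
          exact ⟨t, a, b, ⟨ht, ha, hb⟩, rfl⟩
        · rintro ⟨t, a, b, ⟨ht, ha, hb⟩, rfl⟩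
          exact ⟨a, ha, b, hb, t, ht, rfl⟩
      rw [this]
      exact (isCompact_Icc.prod (h1.prod (hc n))).image (by fun_prop)
    · intro i hi
      rcases Nat.lt_succ_iff_lt_or_eq.1 hi with h | rfl
      · exact (h4 i h).trans (Set.subset_union_left.trans (subset_convexHull _ _))
      · exact Set.subset_union_right.trans (subset_convexHull _ _)

lemma sel {X : Type*} [NormedAddCommGroup X] [NormedSpace ℝ X]
    (F : (X →L[ℝ] ℝ) →L[ℝ] ℝ) (P : ℕ → Set (WeakDual ℝ X)) (a : ℕ → ℝ)
    (hc : ∀ i, IsCompact (P i)) (hv : ∀ i, Convex ℝ (P i))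
    (hF : ∀ i, ∀ ξ ∈ P i, F (WeakDual.toStrongDual ξ) ≤ a i) (n : ℕ) (ε : ℝ) (hε : 0 < ε) :
    ∃ x : X, ∀ i < n, ∀ ξ ∈ P i, ξ x ≤ a i + ε := by
  let Fl : WeakDual ℝ X →ₗ[ℝ] ℝ := F.toLinearMap ∘ₗ WeakDual.toStrongDual.toLinearMap
  let L : WeakDual ℝ X × ℝ →ₗ[ℝ] ℝ := LinearMap.snd ℝ _ _ - Fl ∘ₗ LinearMap.fst ℝ _ _
  have hL : ∀ ξ t, L (ξ, t) = t - F (WeakDual.toStrongDual ξ) := fun ξ t => rfl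
  let S : Set (WeakDual ℝ X × ℝ) := {p | 0 < L p}
  have hS : Convex ℝ S := convex_halfSpace_gt L.isLinear 0
  let Q : ℕ → Set (WeakDual ℝ X × ℝ) := fun i =>
    Nat.rec {((0 : WeakDual ℝ X), (1:ℝ))} (fun j _ => P j ×ˢ {a j + ε}) i
  have hQ0 : Q 0 = {((0 : WeakDual ℝ X), (1:ℝ))} := rfl
  have hQs : ∀ j, Q (j+1) = P j ×ˢ {a j + ε} := fun j => rfl
  obtain ⟨D, h1, h2, h3, h4⟩ := cpt_hull S hS Q (by
      rintro (_ | j)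
      · rw [hQ0]; exact isCompact_singleton
      · rw [hQs]; exact (hc j).prod isCompact_singleton) (by
      rintro (_ | j)
      · rw [hQ0]; exact convex_singleton _
      · rw [hQs]; exact (hv j).prod (convex_singleton _)) (by
      rintro (_ | j)
      · rw [hQ0]; rintro _ rfl
        show 0 < L _
        rw [hL]; simp
      · rw [hQs]; rintro ⟨ξ, t⟩ ⟨h, rfl⟩
        show 0 < L _
        rw [hL]; have := hF j ξ h; linarith) (n+1)
  let T : Set (WeakDual ℝ X × ℝ) := {0} ×ˢ Set.Iic 0
  have hdis : Disjoint T D := by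
    rw [Set.disjoint_left]
    rintro ⟨ξ, t⟩ ⟨h, h'⟩ hD
    have := h3 hD
    change 0 < L _ at this
    simp only [Set.mem_singleton_iff] at h
    subst h
    rw [hL] at this
    simp only [map_zero, sub_zero] at this
    exact absurd h' (by simpa using this)
  have : LocallyConvexSpace ℝ (WeakDual ℝ X) :=
    inferInstanceAs (LocallyConvexSpace ℝ (WeakBilin (topDualPairing ℝ X)))
  obtain ⟨f, u, v, hu, huv, hD⟩ := geometric_hahn_banach_closed_compact (s := T) (t := D)
    ((convex_singleton _).prod (convex_Iic _)) (isClosed_singleton.prod isClosed_Iic) h2 h1 hdis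
  obtain ⟨x, hx⟩ := LinearMap.dualEmbedding_surjective (topDualPairing ℝ X)
    (f.comp (ContinuousLinearMap.inl ℝ (WeakDual ℝ X) ℝ))
  have hfx : ∀ ξ : WeakDual ℝ X, f (ξ, 0) = ξ x := fun ξ => (DFunLike.congr_fun hx ξ).symm
  have hf : ∀ (ξ : WeakDual ℝ X) (t : ℝ), f (ξ, t) = ξ x + t * f (0, 1) := by
    intro ξ t
    have : ((ξ, t) : WeakDual ℝ X × ℝ) = (ξ, 0) + t • (0, 1) := by simp
    rw [this, map_add, map_smul, hfx]; rfl
  have hu0 : 0 < u := by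
    have := hu (0, 0) ⟨rfl, by simp⟩
    rwa [show ((0, 0) : WeakDual ℝ X × ℝ) = 0 from rfl, map_zero] at this
  set s := f (0, 1) with hs
  have hs0 : 0 < s := by
    have := hD (0, 1) (h4 0 (by omega) rfl)
    linarith
  refine ⟨-(s⁻¹ • x), fun i hi ξ hξ => ?_⟩
  have := hD (ξ, a i + ε) (h4 (i+1) (by omega) ⟨hξ, rfl⟩)
  rw [hf] at this
  have h5 : 0 < ξ x + (a i + ε) * s := by linarith
  rw [map_neg, map_smul, smul_eq_mul]
  have h6 : 0 < s⁻¹ * (ξ x + (a i + ε) * s) := by positivity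
  have h7 : s⁻¹ * (ξ x + (a i + ε) * s) = s⁻¹ * ξ x + (a i + ε) := by field_simp
  linarith

lemma wstarClosure_closed {X : Type*} [NormedAddCommGroup X] [NormedSpace ℝ X]
    (A : Set (X →L[ℝ] ℝ)) :
    IsClosed (X := WeakDual ℝ X) (wstarClosure A) :=
  isClosed_closure (X := WeakDual ℝ X)

lemma wstarClosure_convex {X : Type*} [NormedAddCommGroup X] [NormedSpace ℝ X]
    (A : Set (X →L[ℝ] ℝ)) (hA : Convex ℝ A) :
    Convex ℝ (E := WeakDual ℝ X) (wstarClosure A) :=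
  Convex.closure (E := WeakDual ℝ X) (𝕜 := ℝ) hA

lemma subset_wstarClosure {X : Type*} [NormedAddCommGroup X] [NormedSpace ℝ X]
    (A : Set (X →L[ℝ] ℝ)) : A ⊆ wstarClosure A :=
  subset_closure (X := WeakDual ℝ X)

lemma wstarClosure_min {X : Type*} [NormedAddCommGroup X] [NormedSpace ℝ X]
    {A B : Set (X →L[ℝ] ℝ)} (h : A ⊆ B) (hB : IsClosed (X := WeakDual ℝ X) B) :
    wstarClosure A ⊆ B :=
  closure_minimal (X := WeakDual ℝ X) h hB

lemma Ienv_closed {X : Type*} [NormedAddCommGroup X] [NormedSpace ℝ X]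
    (A : Set (X →L[ℝ] ℝ)) : IsClosed (Ienv A) :=
  isClosed_iInter fun _ => isClosed_iInter fun _ => isClosed_closure

lemma Ienv_le_of_B1 {X : Type*} [NormedAddCommGroup X] [NormedSpace ℝ X]
    (F : (X →L[ℝ] ℝ) →L[ℝ] ℝ) (hF : F ∈ B1 X) (A : Set (X →L[ℝ] ℝ))
    (hA : ∀ ξ ∈ A, F ξ ≤ 0) : ∀ ξ ∈ Ienv A, F ξ ≤ 0 := by
  obtain ⟨x, hx⟩ := hF
  intro ξ hξ
  refine le_of_forall_pos_le_add fun ε hε => ?_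
  rw [zero_add]
  let K : ℕ → Set (X →L[ℝ] ℝ) := fun n => {η | ∀ k ≥ n, η (x k) ≤ ε}
  have hKc : ∀ n, IsClosed (X := WeakDual ℝ X) (K n) := by
    intro n
    have h : IsClosed (⋂ k, ⋂ (_ : k ≥ n), {η : WeakDual ℝ X | η (x k) ≤ ε}) :=
      isClosed_iInter fun k => isClosed_iInter fun _ =>
        isClosed_le (WeakDual.eval_continuous (x k)) continuous_const
    have h' : (⋂ k, ⋂ (_ : k ≥ n), {η : WeakDual ℝ X | η (x k) ≤ ε}) =
        {η : WeakDual ℝ X | ∀ k ≥ n, η (x k) ≤ ε} := by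
      ext η; simp
    rw [h'] at h
    exact h
  have hKv : ∀ n, Convex ℝ (K n) := by
    intro n η hη ζ hζ a b ha hb hab k hk
    have h1 := hη k hk
    have h2 := hζ k hk
    simp only [add_apply, smul_apply, smul_eq_mul]
    nlinarith
  simp only [Ienv, Set.mem_iInter] at hξ
  have h1 := hξ (fun n => A ∩ K n) (by
    rw [← Set.inter_iUnion]
    refine (Set.inter_eq_left.2 fun η hη => ?_).symm
    have := (hx η).eventually_le_const (lt_of_le_of_lt (hA η hη) hε)
    obtain ⟨n, hn⟩ := eventually_atTop.1 this
    exact Set.mem_iUnion.2 ⟨n, hn⟩)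
  have hcl : IsClosed {η : X →L[ℝ] ℝ | F η ≤ ε} := isClosed_le F.continuous continuous_const
  refine closure_minimal (convexHull_min ?_ ?_) hcl h1
  · refine Set.iUnion_subset fun n => ?_
    intro η hη
    have h2 : η ∈ K n := wstarClosure_min
      (convexHull_min Set.inter_subset_right (hKv n)) (hKc n) hη
    exact le_of_tendsto (hx η) (eventually_atTop.2 ⟨n, h2⟩)
  · exact convex_halfSpace_le F.toLinearMap.isLinear ε

lemma B1_neg {X : Type*} [NormedAddCommGroup X] [NormedSpace ℝ X]
    (F : (X →L[ℝ] ℝ) →L[ℝ] ℝ) (hF : F ∈ B1 X) : -F ∈ B1 X := by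
  obtain ⟨x, hx⟩ := hF
  exact ⟨fun n => -x n, fun ξ => by simpa using (hx ξ).neg⟩

/-- Half-spaces that are (I)-closed are covered by countably many good sets. -/
lemma cover {X : Type*} [NormedAddCommGroup X] [NormedSpace ℝ X]
    (F : (X →L[ℝ] ℝ) →L[ℝ] ℝ) (hF0 : F ≠ 0) (q r : ℝ) (hqr : q < r)
    (hq : Ienv {ξ | F ξ ≤ q} = {ξ | F ξ ≤ q}) :
    ∃ C : ℕ → Set (WeakDual ℝ X), (∀ n, IsClosed (C n)) ∧ (∀ n, Convex ℝ (C n)) ∧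
      (∀ n, ∀ ξ ∈ C n, F (WeakDual.toStrongDual ξ) ≤ r) ∧
      ∀ ξ : WeakDual ℝ X, F (WeakDual.toStrongDual ξ) ≤ q → ∃ n, ξ ∈ C n := by
  obtain ⟨e, he⟩ : ∃ e, F e ≠ 0 := by
    by_contra! h
    exact hF0 (ContinuousLinearMap.ext h)
  let e₁ := (F e)⁻¹ • e
  have he₁ : F e₁ = 1 := by simp [e₁, he]
  have hr : r • e₁ ∉ Ienv {ξ | F ξ ≤ q} := by
    rw [hq]; simp [he₁, hqr]
  simp only [Ienv, Set.mem_iInter, not_forall] at hr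
  obtain ⟨As, hAs, hr⟩ := hr
  obtain ⟨G, u, hG, hu⟩ := geometric_hahn_banach_closed_point
    (convex_convexHull ℝ _).closure isClosed_closure hr
  have hsub : ∀ n, ∀ ξ ∈ wstarClosure (convexHull ℝ (As n)), G ξ < u := fun n ξ h =>
    hG ξ (subset_closure (subset_convexHull _ _ (Set.mem_iUnion.2 ⟨n, h⟩)))
  have hAsub : ∀ n, As n ⊆ wstarClosure (convexHull ℝ (As n)) := fun n =>
    (subset_convexHull _ _).trans (subset_wstarClosure _)
  have hA : ∀ ξ, F ξ ≤ q → G ξ < u := by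
    intro ξ h
    have : ξ ∈ ⋃ n, As n := hAs ▸ h
    obtain ⟨n, hn⟩ := Set.mem_iUnion.1 this
    exact hsub n ξ (hAsub n hn)
  have hker : ∀ ξ, F ξ = 0 → G ξ = 0 := by
    intro ξ h
    by_contra hne
    have := hA (q • e₁ + ((u - q * G e₁) / G ξ) • ξ) (by simp [he₁, h])
    simp only [map_add, map_smul, smul_eq_mul] at this
    rw [div_mul_cancel₀ _ hne] at this
    linarith
  have hGF : ∀ ξ, G ξ = F ξ * G e₁ := by
    intro ξ
    have := hker (ξ - F ξ • e₁) (by simp [he₁])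
    simp only [map_sub, map_smul, smul_eq_mul] at this
    linarith
  have hpos : 0 < G e₁ := by
    have h1 := hA (q • e₁) (by simp [he₁])
    simp only [map_smul, smul_eq_mul] at h1 hu
    by_contra! hneg
    nlinarith
  refine ⟨fun n => wstarClosure (convexHull ℝ (As n)), fun n => wstarClosure_closed _,
    fun n => wstarClosure_convex _ (convex_convexHull _ _), ?_, ?_⟩
  · intro n ξ h
    have h1 : G (WeakDual.toStrongDual ξ) < u := hsub n _ h
    rw [hGF] at h1
    simp only [map_smul, smul_eq_mul] at hu
    by_contra! h2
    nlinarith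
  · intro ξ h
    have : WeakDual.toStrongDual ξ ∈ ⋃ n, As n := hAs ▸ h
    obtain ⟨n, hn⟩ := Set.mem_iUnion.1 this
    exact ⟨n, hAsub n hn⟩

lemma mem_B1 {X : Type*} [NormedAddCommGroup X] [NormedSpace ℝ X]
    (F : (X →L[ℝ] ℝ) →L[ℝ] ℝ)
    (hF : ∀ q : ℝ, Ienv {ξ | F ξ ≤ q} = {ξ | F ξ ≤ q}) : F ∈ B1 X := by
  by_cases hF0 : F = 0
  · exact ⟨fun _ => 0, by simp [hF0]⟩
  have H : ∀ (p : {p : ℚ × ℚ // p.1 < p.2}), _ := fun p =>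
    cover F hF0 (p.1.1 : ℝ) (p.1.2 : ℝ) (by exact_mod_cast p.2) (hF _)
  choose C h1 h2 h3 h4 using H
  have : Nonempty ({p : ℚ × ℚ // p.1 < p.2} × ℕ × ℕ) := ⟨⟨⟨(0, 1), by norm_num⟩, 0, 0⟩⟩
  obtain ⟨φ, hφ⟩ := exists_surjective_nat ({p : ℚ × ℚ // p.1 < p.2} × ℕ × ℕ)
  let P : ℕ → Set (WeakDual ℝ X) := fun i => C (φ i).1 (φ i).2.1 ∩
    WeakDual.toStrongDual ⁻¹' Metric.closedBall 0 ((φ i).2.2 : ℝ)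
  let a : ℕ → ℝ := fun i => ((φ i).1.1.2 : ℝ)
  have hc : ∀ i, IsCompact (P i) := fun i =>
    (WeakDual.isCompact_closedBall 0 _).inter_left (h1 _ _)
  have hv : ∀ i, Convex ℝ (P i) := fun i => (h2 _ _).inter
    ((convex_closedBall (0 : StrongDual ℝ X) _).linear_preimage WeakDual.toStrongDual.toLinearMap)
  have hPF : ∀ i, ∀ ξ ∈ P i, F (WeakDual.toStrongDual ξ) ≤ a i := fun i ξ h => h3 _ _ ξ h.1
  choose x hx using fun n : ℕ => sel F P a hc hv hPF n (1 / ((n:ℝ) + 1)) (by positivity)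
  have key : ∀ (ξ : X →L[ℝ] ℝ) (b : ℝ), F ξ < b → ∀ᶠ n in atTop, ξ (x n) < b := by
    intro ξ b hb
    obtain ⟨q, hq, hqb⟩ := exists_rat_btwn hb
    obtain ⟨r, hr, hrb⟩ := exists_rat_btwn hqb
    have hqr : q < r := by exact_mod_cast hr
    obtain ⟨n, hn⟩ := h4 ⟨(q, r), hqr⟩ (StrongDual.toWeakDual ξ) hq.le
    obtain ⟨k, hk⟩ := exists_nat_ge ‖ξ‖
    obtain ⟨i, hi⟩ := hφ (⟨(q, r), hqr⟩, n, k)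
    have hξ : StrongDual.toWeakDual ξ ∈ P i := by
      simp only [P, hi]
      exact ⟨hn, by simpa using hk⟩
    have hai : a i = r := by simp only [a, hi]
    have ht : ∀ᶠ m : ℕ in atTop, 1 / ((m:ℝ) + 1) < b - r :=
      tendsto_one_div_add_atTop_nhds_zero_nat.eventually_lt_const (by linarith)
    filter_upwards [ht, eventually_gt_atTop i] with m hm him
    have := hx m i him _ hξ
    rw [hai] at this
    change ξ (x m) ≤ _ at this
    linarith
  refine ⟨x, fun ξ => tendsto_order.2 ⟨fun b hb => ?_, fun b hb => key ξ b hb⟩⟩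
  have := key (-ξ) (-b) (by simpa using hb)
  filter_upwards [this] with n hn
  simpa using hn

lemma tvs_sep {V : Type*} [AddCommGroup V] [Module ℝ V] [TopologicalSpace V]
    [IsTopologicalAddGroup V] [ContinuousSMul ℝ V] [LocallyConvexSpace ℝ V] (A : Set V) (ξ : V)
    (h : ξ ∉ closure (convexHull ℝ A)) : ∃ (f : V →ₗ[ℝ] ℝ) (u : ℝ), Continuous f ∧
      (∀ η ∈ convexHull ℝ A, f η < u) ∧ u < f ξ := by
  obtain ⟨f, u, h1, h2⟩ := geometric_hahn_banach_closed_point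
    (convex_convexHull ℝ A).closure isClosed_closure h
  exact ⟨f.toLinearMap, u, f.continuous, fun η hη => h1 η (subset_closure hη), h2⟩

lemma fwd1 {X : Type*} [NormedAddCommGroup X] [NormedSpace ℝ X]
    (f : (X →L[ℝ] ℝ) →ₗ[ℝ] ℝ) (h : ∀ q : ℝ, Ienv {ξ | f ξ ≤ q} = {ξ | f ξ ≤ q})
    (h' : Ienv {ξ | 0 ≤ f ξ} = {ξ | 0 ≤ f ξ}) : ∃ F ∈ B1 X, ∀ ξ, F ξ = f ξ := by
  have hcl : IsClosed (LinearMap.ker f : Set (X →L[ℝ] ℝ)) := by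
    have h1 := Ienv_closed {ξ | f ξ ≤ 0}
    have h2 := Ienv_closed {ξ | 0 ≤ f ξ}
    rw [h] at h1
    rw [h'] at h2
    convert h1.inter h2 using 1
    ext ξ
    simp [le_antisymm_iff]
  let F : (X →L[ℝ] ℝ) →L[ℝ] ℝ := ⟨f, f.continuous_of_isClosed_ker hcl⟩
  exact ⟨F, mem_B1 F h, fun ξ => rfl⟩

lemma fwd2 {X : Type*} [NormedAddCommGroup X] [NormedSpace ℝ X]
    (F : (X →L[ℝ] ℝ) →L[ℝ] ℝ) (hF : F ∈ B1 X) : ∃ f : (X →L[ℝ] ℝ) →ₗ[ℝ] ℝ,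
      (∀ ξ, F ξ = f ξ) ∧ Ienv {ξ | f ξ = 0} ⊆ {ξ | f ξ = 0} := by
  refine ⟨F.toLinearMap, fun ξ => rfl, fun ξ hξ => ?_⟩
  have h1 := Ienv_le_of_B1 F hF _ (fun η (hη : F η = 0) => hη.le) ξ hξ
  have h2 := Ienv_le_of_B1 (-F) (B1_neg F hF) {ξ | F ξ = 0}
    (fun η (hη : F η = 0) => by simp [hη]) ξ hξ
  have h3 : -F ξ ≤ 0 := h2
  have h4 : 0 ≤ F ξ := by linarith
  exact le_antisymm h1 h4

lemma sigma_cont {X : Type*} [NormedAddCommGroup X] [NormedSpace ℝ X]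
    (F : (X →L[ℝ] ℝ) →L[ℝ] ℝ) (hF : F ∈ B1 X) : @Continuous _ _ (sigmaTop (B1 X)) _ F := by
  have h := @continuous_induced_dom _ _
    (fun f (y : B1 X) => (y : (X →L[ℝ] ℝ) →L[ℝ] ℝ) f) Pi.topologicalSpace
  have h2 : Continuous (fun p : B1 X → ℝ => p ⟨F, hF⟩) := continuous_apply (⟨F, hF⟩ : B1 X)
  have h3 := @Continuous.comp _ _ _ (sigmaTop (B1 X)) _ _ _ _ h2 h
  exact h3

theorem stmt5 {X : Type*} [NormedAddCommGroup X] [NormedSpace ℝ X] [CompleteSpace X] :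
    (∃ τ : TopologicalSpace (X →L[ℝ] ℝ),
        @IsTopologicalAddGroup (X →L[ℝ] ℝ) τ _ ∧
        @ContinuousSMul ℝ (X →L[ℝ] ℝ) _ _ τ ∧
        @LocallyConvexSpace ℝ (X →L[ℝ] ℝ) _ _ _ _ τ ∧
        ∀ A : Set (X →L[ℝ] ℝ), Ienv A = @closure _ τ (convexHull ℝ A)) ↔
      (∀ A : Set (X →L[ℝ] ℝ),
        Ienv A = @closure _ (sigmaTop (B1 X)) (convexHull ℝ A)) := by
  constructor
  · rintro ⟨τ, hτ1, hτ2, hτ3, hτ⟩ A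
    -- τ-continuous functionals belong to `B1`
    have hB : ∀ f : (X →L[ℝ] ℝ) →ₗ[ℝ] ℝ, @Continuous _ _ τ _ f →
        ∃ F ∈ B1 X, ∀ ξ, F ξ = f ξ := by
      intro f hf
      have hI : ∀ q : ℝ, Ienv {ξ | f ξ ≤ q} = {ξ | f ξ ≤ q} := by
        intro q
        rw [hτ, (convex_halfSpace_le f.isLinear q).convexHull_eq]
        exact @IsClosed.closure_eq _ τ _ (@IsClosed.preimage _ _ τ _ f hf _ isClosed_Iic)
      refine fwd1 f hI ?_
      rw [hτ, (convex_halfSpace_ge f.isLinear 0).convexHull_eq]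
      exact @IsClosed.closure_eq _ τ _ (@IsClosed.preimage _ _ τ _ f hf _ isClosed_Ici)
    -- elements of `B1` are τ-continuous
    have hC : ∀ F ∈ B1 X, @Continuous _ _ τ _ F := by
      intro F hF
      obtain ⟨f, hf, hsub⟩ := fwd2 F hF
      have hcl : @IsClosed _ τ (LinearMap.ker f : Set (X →L[ℝ] ℝ)) := by
        refine @isClosed_of_closure_subset _ τ _ ?_
        have h := hτ {ξ | f ξ = 0}
        rw [(convex_hyperplane f.isLinear 0).convexHull_eq] at h
        exact h.symm.subset.trans hsub
      have hFf : (fun ξ => F ξ) = f := funext hf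
      have := f.continuous_of_isClosed_ker hcl
      rw [← hFf] at this
      exact this
    have hle : τ ≤ sigmaTop (B1 X) := by
      rw [sigmaTop, ← continuous_iff_le_induced]
      exact @continuous_pi _ _ _ τ _ _ fun F => hC F.1 F.2
    rw [hτ]
    refine Set.Subset.antisymm ?_ ?_
    · exact closure.mono hle
    · intro ξ hξ
      by_contra hn
      obtain ⟨f, u, hfc, h1, h2⟩ := tvs_sep A ξ hn
      obtain ⟨F, hF, hFf⟩ := hB f hfc
      have hFc := sigma_cont F hF
      have h3 : ξ ∈ {η | F η ≤ u} := by
        refine Set.mem_of_subset_of_mem (@closure_minimal _ (sigmaTop (B1 X)) _ _ ?_ ?_) hξ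
        · intro η hη
          have := h1 η hη
          exact ((hFf η).trans_lt this).le
        · exact @IsClosed.preimage _ _ (sigmaTop (B1 X)) _ F hFc _ isClosed_Iic
      have h4 : F ξ = f ξ := hFf ξ
      have h5 : F ξ ≤ u := h3
      linarith
  · intro h
    let L : (X →L[ℝ] ℝ) →ₗ[ℝ] (B1 X → ℝ) := LinearMap.pi fun F => F.1.toLinearMap
    refine ⟨TopologicalSpace.induced L Pi.topologicalSpace, topologicalAddGroup_induced L,
      continuousSMul_induced L, LocallyConvexSpace.induced L, h⟩
end
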